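/- Let M be an ergodic row-stochastic matrix on a finite state space Ω with generalized contraction coefficient κ̃ and mixing time t_mix = t_mix(1/4). Then (1/2)/(1 − κ̃) ≤ t_mix ≤ (1 + ln 4)/(1 − κ̃). -/

import Mathlib

variable {Ω : Type*} [Fintype Ω] [DecidableEq Ω] [Nonempty Ω]

/-- A probability distribution on `Ω`. -/
def IsDist (f : Ω → ℝ) : Prop := (∀ x, 0 ≤ f x) ∧ ∑ x, f x = 1

/-- A row-stochastic (Markov) matrix. -/
def IsStochastic (M : Matrix Ω Ω ℝ) : Prop :=
  (∀ i j, 0 ≤ M i j) ∧ ∀ i, ∑ j, M i j = 1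

/-- Ergodicity: some power of `M` is entrywise positive. -/
def IsErgodic (M : Matrix Ω Ω ℝ) : Prop := ∃ p : ℕ, 0 < p ∧ ∀ i j, 0 < (M ^ p) i j

/-- Total variation distance between two distributions on `Ω`. -/
noncomputable def tvDist (μ ν : Ω → ℝ) : ℝ := (1 / 2) * ∑ x, |μ x - ν x|

/-- Dobrushin contraction coefficient `κ(M) = max_{i,j} ‖M(i,·) − M(j,·)‖_TV`. -/
noncomputable def dobrushin (M : Matrix Ω Ω ℝ) : ℝ :=
  Finset.univ.sup' Finset.univ_nonempty fun p : Ω × Ω => tvDist (M p.1) (M p.2)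

/-- Generalized contraction coefficient `κ̃ = 1 − sup_{s ≥ 1} (1 − κ(M^s))/s`. -/
noncomputable def genCC (M : Matrix Ω Ω ℝ) : ℝ :=
  1 - ⨆ s : {n : ℕ // 0 < n}, (1 - dobrushin (M ^ (s : ℕ))) / ((s : ℕ) : ℝ)

/-- Distance to stationarity `h(t) = sup_{μ ∈ Δ_Ω} ‖μ M^t − π‖_TV`. -/
noncomputable def distToStat (M : Matrix Ω Ω ℝ) (π : Ω → ℝ) (t : ℕ) : ℝ :=
  ⨆ μ : {f : Ω → ℝ // IsDist f}, tvDist (Matrix.vecMul μ.1 (M ^ t)) π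

/-- Mixing time `t_mix(ξ) = min{t ∈ ℕ : h(t) < ξ}` (with `ℕ = {1,2,…}`). -/
noncomputable def mixTime (M : Matrix Ω Ω ℝ) (π : Ω → ℝ) (ξ : ℝ) : ℕ :=
  sInf {t : ℕ | 0 < t ∧ distToStat M π t < ξ}

omit [Nonempty Ω] in
theorem IsStochastic.pow {M : Matrix Ω Ω ℝ} (hM : IsStochastic M) (n : ℕ) :
    IsStochastic (M ^ n) := by
  induction n with
  | zero => exact ⟨fun i j => by rw [pow_zero, Matrix.one_apply]; split_ifs <;> norm_num,
      fun i => by simp [Matrix.one_apply]⟩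
  | succ n ih =>
    refine ⟨fun i j => ?_, fun i => ?_⟩
    · rw [pow_succ, Matrix.mul_apply]
      exact Finset.sum_nonneg fun k _ => mul_nonneg (ih.1 i k) (hM.1 k j)
    · simp_rw [pow_succ, Matrix.mul_apply]
      rw [Finset.sum_comm]
      simp_rw [← Finset.mul_sum, hM.2, mul_one, ih.2]

omit [DecidableEq Ω] [Nonempty Ω] in
theorem IsStochastic.isDist_row {M : Matrix Ω Ω ℝ} (hM : IsStochastic M) (i : Ω) :
    IsDist (M i) := ⟨hM.1 i, hM.2 i⟩

omit [DecidableEq Ω] [Nonempty Ω] in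
theorem IsStochastic.sum_vecMul {M : Matrix Ω Ω ℝ} (hM : IsStochastic M) (v : Ω → ℝ) :
    ∑ y, Matrix.vecMul v M y = ∑ x, v x := by
  simp_rw [Matrix.vecMul, dotProduct]
  rw [Finset.sum_comm]
  simp_rw [← Finset.mul_sum, hM.2, mul_one]

omit [DecidableEq Ω] [Nonempty Ω] in
theorem IsStochastic.isDist_vecMul {M : Matrix Ω Ω ℝ} (hM : IsStochastic M) {μ : Ω → ℝ}
    (hμ : IsDist μ) : IsDist (Matrix.vecMul μ M) :=
  ⟨fun y => Finset.sum_nonneg fun x _ => mul_nonneg (hμ.1 x) (hM.1 x y),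
    (hM.sum_vecMul μ).trans hμ.2⟩

omit [DecidableEq Ω] [Nonempty Ω] in
theorem tvDist_nonneg (μ ν : Ω → ℝ) : 0 ≤ tvDist μ ν := by
  unfold tvDist; positivity

omit [DecidableEq Ω] [Nonempty Ω] in
theorem tvDist_comm (μ ν : Ω → ℝ) : tvDist μ ν = tvDist ν μ := by
  simp only [tvDist, abs_sub_comm]

omit [DecidableEq Ω] [Nonempty Ω] in
theorem tvDist_triangle (μ ν ρ : Ω → ℝ) : tvDist μ ρ ≤ tvDist μ ν + tvDist ν ρ := by
  unfold tvDist
  rw [← mul_add, ← Finset.sum_add_distrib]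
  gcongr
  exact abs_sub_le _ _ _

omit [DecidableEq Ω] [Nonempty Ω] in
theorem tvDist_le_one {μ ν : Ω → ℝ} (hμ : IsDist μ) (hν : IsDist ν) : tvDist μ ν ≤ 1 := by
  have : ∑ x, |μ x - ν x| ≤ ∑ x, (μ x + ν x) := by
    gcongr with x
    exact abs_sub_le_iff.2 ⟨by linarith [hν.1 x], by linarith [hμ.1 x]⟩
  rw [Finset.sum_add_distrib, hμ.2, hν.2] at this
  unfold tvDist
  linarith

omit [DecidableEq Ω] in
theorem tvDist_lt_one_of_pos {μ ν : Ω → ℝ} (hμ : IsDist μ) (hν : IsDist ν)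
    (hμ' : ∀ x, 0 < μ x) (hν' : ∀ x, 0 < ν x) : tvDist μ ν < 1 := by
  have : ∑ x, |μ x - ν x| < ∑ x, (μ x + ν x) :=
    Finset.sum_lt_sum_of_nonempty Finset.univ_nonempty fun x _ =>
      abs_sub_lt_iff.2 ⟨by linarith [hν' x], by linarith [hμ' x]⟩
  rw [Finset.sum_add_distrib, hμ.2, hν.2] at this
  unfold tvDist
  linarith

omit [DecidableEq Ω] in
theorem tvDist_le_dobrushin (M : Matrix Ω Ω ℝ) (i j : Ω) : tvDist (M i) (M j) ≤ dobrushin M :=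
  Finset.le_sup' (fun p : Ω × Ω => tvDist (M p.1) (M p.2)) (Finset.mem_univ (i, j))

omit [DecidableEq Ω] in
theorem dobrushin_nonneg (M : Matrix Ω Ω ℝ) : 0 ≤ dobrushin M :=
  (tvDist_nonneg _ _).trans
    (tvDist_le_dobrushin M (Classical.arbitrary Ω) (Classical.arbitrary Ω))

omit [DecidableEq Ω] in
theorem IsStochastic.dobrushin_lt_one_of_pos {M : Matrix Ω Ω ℝ} (hM : IsStochastic M)
    (hpos : ∀ i j, 0 < M i j) : dobrushin M < 1 :=
  (Finset.sup'_lt_iff _).2 fun _ _ =>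
    tvDist_lt_one_of_pos (hM.isDist_row _) (hM.isDist_row _) (hpos _) (hpos _)

omit [DecidableEq Ω] in
/-- A matrix contracts the `ℓ¹` norm of a mean-zero vector by its Dobrushin coefficient. -/
theorem sum_abs_vecMul_le (M : Matrix Ω Ω ℝ) {v : Ω → ℝ} (hv : ∑ x, v x = 0) :
    ∑ y, |Matrix.vecMul v M y| ≤ dobrushin M * ∑ x, |v x| := by
  set a : Ω → ℝ := fun x => max (v x) 0 with ha
  set b : Ω → ℝ := fun x => max (-v x) 0 with hb
  have ha0 : ∀ x, 0 ≤ a x := fun x => le_max_right _ _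
  have hb0 : ∀ x, 0 ≤ b x := fun x => le_max_right _ _
  have hsub : ∀ x, v x = a x - b x := fun x => by
    simp only [ha, hb]
    rcases le_total 0 (v x) with h | h <;> simp [h]
  have habs : ∀ x, |v x| = a x + b x := fun x => by
    simp only [ha, hb]
    rcases le_total 0 (v x) with h | h <;> simp [h, abs_of_nonneg, abs_of_nonpos]
  set m := ∑ x, a x with hm
  have hbm : ∑ x, b x = m := by
    simp_rw [hsub, Finset.sum_sub_distrib] at hv
    linarith
  have hm0 : 0 ≤ m := Finset.sum_nonneg fun x _ => ha0 x
  have hvm : ∑ x, |v x| = 2 * m := by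
    simp_rw [habs, Finset.sum_add_distrib, hbm]
    ring
  rcases hm0.eq_or_lt with h0 | hpos
  · have hv0 : v = 0 := by
      rw [← h0, mul_zero, Finset.sum_eq_zero_iff_of_nonneg fun x _ => abs_nonneg _] at hvm
      exact funext fun x => abs_eq_zero.1 (hvm x (Finset.mem_univ x))
    simp [hv0]
  have key : ∀ y, m * Matrix.vecMul v M y = ∑ i, ∑ j, a i * b j * (M i y - M j y) := fun y => by
    have h1 : ∑ i, ∑ j, a i * b j * M i y = m * ∑ i, a i * M i y := by
      simp_rw [mul_right_comm _ (b _), ← Finset.mul_sum, hbm, ← Finset.sum_mul]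
      ring
    have h2 : ∑ i, ∑ j, a i * b j * M j y = m * ∑ j, b j * M j y := by
      simp_rw [mul_assoc, ← Finset.mul_sum, ← Finset.sum_mul, hm]
    simp_rw [mul_sub, Finset.sum_sub_distrib]
    rw [h1, h2, ← mul_sub, ← Finset.sum_sub_distrib]
    simp_rw [← sub_mul, ← hsub]
    rfl
  have hle : m * ∑ y, |Matrix.vecMul v M y| ≤ m * (dobrushin M * ∑ x, |v x|) := by
    calc m * ∑ y, |Matrix.vecMul v M y|
        = ∑ y, |∑ i, ∑ j, a i * b j * (M i y - M j y)| := by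
          simp_rw [Finset.mul_sum, ← key, abs_mul, abs_of_pos hpos]
      _ ≤ ∑ y, ∑ i, ∑ j, a i * b j * |M i y - M j y| := by
          gcongr with y
          refine (Finset.abs_sum_le_sum_abs _ _).trans ?_
          gcongr with i
          refine (Finset.abs_sum_le_sum_abs _ _).trans ?_
          gcongr with j
          rw [abs_mul, abs_of_nonneg (mul_nonneg (ha0 i) (hb0 j))]
      _ = ∑ i, ∑ j, a i * b j * (2 * tvDist (M i) (M j)) := by
          rw [Finset.sum_comm]
          refine Finset.sum_congr rfl fun i _ => ?_
          rw [Finset.sum_comm]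
          refine Finset.sum_congr rfl fun j _ => ?_
          rw [← Finset.mul_sum, tvDist]
          ring
      _ ≤ ∑ i, ∑ j, a i * b j * (2 * dobrushin M) := by
          gcongr with i _ j _
          exact tvDist_le_dobrushin M i j
      _ = m * (dobrushin M * ∑ x, |v x|) := by
          simp_rw [← Finset.sum_mul, ← Finset.mul_sum, hbm, ← Finset.sum_mul, hvm]
          ring
  exact le_of_mul_le_mul_left hle hpos

theorem IsStochastic.sum_abs_vecMul_pow_le {M : Matrix Ω Ω ℝ} (hM : IsStochastic M) {v : Ω → ℝ}
    (hv : ∑ x, v x = 0) (k : ℕ) :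
    ∑ y, |Matrix.vecMul v (M ^ k) y| ≤ dobrushin M ^ k * ∑ x, |v x| := by
  induction k with
  | zero => simp
  | succ k ih =>
    rw [pow_succ, ← Matrix.vecMul_vecMul, pow_succ', mul_assoc]
    exact (sum_abs_vecMul_le M (((hM.pow k).sum_vecMul v).trans hv)).trans
      (mul_le_mul_of_nonneg_left ih (dobrushin_nonneg M))

omit [Nonempty Ω] in
theorem vecMul_pow_eq_self {M : Matrix Ω Ω ℝ} {π : Ω → ℝ} (h : Matrix.vecMul π M = π) (n : ℕ) :
    Matrix.vecMul π (M ^ n) = π := by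
  induction n with
  | zero => simp
  | succ n ih => rw [pow_succ, ← Matrix.vecMul_vecMul, ih, h]

omit [Nonempty Ω] in
theorem isDist_single (i : Ω) : IsDist (Pi.single i 1) :=
  ⟨fun x => by by_cases h : x = i <;> simp [h], by simp⟩

theorem distToStat_mul_le {M : Matrix Ω Ω ℝ} (hM : IsStochastic M) {π : Ω → ℝ} (hπ : IsDist π)
    (hstat : Matrix.vecMul π M = π) (s k : ℕ) :
    distToStat M π (s * k) ≤ dobrushin (M ^ s) ^ k := by
  have : Nonempty {f : Ω → ℝ // IsDist f} := ⟨⟨π, hπ⟩⟩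
  refine ciSup_le fun ⟨μ, hμ⟩ => ?_
  have hv : ∑ x, (μ - π) x = 0 := by simp [Finset.sum_sub_distrib, hμ.2, hπ.2]
  have h := (hM.pow s).sum_abs_vecMul_pow_le hv k
  rw [← pow_mul, Matrix.sub_vecMul, vecMul_pow_eq_self hstat] at h
  have h1 := tvDist_le_one hμ hπ
  have h0 := pow_nonneg (dobrushin_nonneg (M ^ s)) k
  simp only [tvDist, Pi.sub_apply] at h h1 ⊢
  nlinarith

omit [Nonempty Ω] in
theorem tvDist_le_distToStat {M : Matrix Ω Ω ℝ} (hM : IsStochastic M) {π : Ω → ℝ}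
    (hπ : IsDist π) (t : ℕ) {μ : Ω → ℝ} (hμ : IsDist μ) :
    tvDist (Matrix.vecMul μ (M ^ t)) π ≤ distToStat M π t := by
  refine le_ciSup (f := fun μ : {f : Ω → ℝ // IsDist f} =>
    tvDist (Matrix.vecMul μ.1 (M ^ t)) π) ⟨1, ?_⟩ ⟨μ, hμ⟩
  rintro _ ⟨ν, rfl⟩
  exact tvDist_le_one ((hM.pow t).isDist_vecMul ν.2) hπ

theorem dobrushin_pow_le_two_mul_distToStat {M : Matrix Ω Ω ℝ} (hM : IsStochastic M)
    {π : Ω → ℝ} (hπ : IsDist π) (t : ℕ) : dobrushin (M ^ t) ≤ 2 * distToStat M π t := by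
  have hrow : ∀ i, tvDist ((M ^ t) i) π ≤ distToStat M π t := fun i => by
    have h := tvDist_le_distToStat hM hπ t (isDist_single i)
    rwa [Matrix.single_one_vecMul] at h
  refine Finset.sup'_le _ _ fun p _ => ?_
  have h := tvDist_triangle ((M ^ t) p.1) π ((M ^ t) p.2)
  rw [tvDist_comm π] at h
  linarith [hrow p.1, hrow p.2]

/-- If `κ(M^s) < 1`, then some multiple of `s` which is at most `(1 + ln 4) s / (1 - κ(M^s))`
is a time at which the distance to stationarity is below `1/4`. -/
theorem exists_distToStat_lt {M : Matrix Ω Ω ℝ} (hM : IsStochastic M) {π : Ω → ℝ}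
    (hπ : IsDist π) (hstat : Matrix.vecMul π M = π) {s : ℕ} (hs : 0 < s)
    (hκ : dobrushin (M ^ s) < 1) :
    ∃ t : ℕ, 0 < t ∧ distToStat M π t < 1 / 4 ∧
      (t : ℝ) * (1 - dobrushin (M ^ s)) ≤ (1 + Real.log 4) * s := by
  have hκ0 := dobrushin_nonneg (M ^ s)
  have hle := distToStat_mul_le hM hπ hstat s
  generalize dobrushin (M ^ s) = κ at hκ hκ0 hle ⊢
  have hd : 0 < 1 - κ := by linarith
  have hlog : 0 < Real.log 4 := Real.log_pos (by norm_num)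
  have hx : 0 < Real.log 4 / (1 - κ) := div_pos hlog hd
  have hk : 0 < ⌈Real.log 4 / (1 - κ)⌉₊ := Nat.ceil_pos.2 hx
  have hk1 := Nat.le_ceil (Real.log 4 / (1 - κ))
  have hk2 := Nat.ceil_lt_add_one hx.le
  generalize ⌈Real.log 4 / (1 - κ)⌉₊ = k at hk hk1 hk2
  rw [div_le_iff₀ hd] at hk1
  refine ⟨s * k, Nat.mul_pos hs hk, (hle k).trans_lt ?_, ?_⟩
  · have hexp : κ < Real.exp (-(1 - κ)) := by
      have := Real.add_one_lt_exp (x := -(1 - κ)) (by linarith)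
      linarith
    calc κ ^ k < Real.exp (-(1 - κ)) ^ k := pow_lt_pow_left₀ hexp hκ0 hk.ne'
      _ = Real.exp (-(k * (1 - κ))) := by rw [← Real.exp_nat_mul, mul_neg]
      _ ≤ Real.exp (-Real.log 4) := by gcongr
      _ = 1 / 4 := by rw [Real.exp_neg, Real.exp_log (by norm_num), one_div]
  · have hk3 : (k : ℝ) * (1 - κ) ≤ 1 + Real.log 4 := by
      have h := mul_le_mul_of_nonneg_right hk2.le hd.le
      rw [add_mul, div_mul_cancel₀ _ hd.ne'] at h
      linarith
    push_cast
    rw [mul_assoc, mul_comm]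
    gcongr

/-- `(1/2)/(1 − κ̃) ≤ t_mix ≤ (1 + ln 4)/(1 − κ̃)` where `t_mix = t_mix(1/4)`. -/
theorem mixTime_two_sided (M : Matrix Ω Ω ℝ) (hM : IsStochastic M)
    (hErg : IsErgodic M) (π : Ω → ℝ) (hπ : IsDist π)
    (hstat : Matrix.vecMul π M = π) :
    (1 / 2) / (1 - genCC M) ≤ (mixTime M π (1 / 4) : ℝ) ∧
      (mixTime M π (1 / 4) : ℝ) ≤ (1 + Real.log 4) / (1 - genCC M) := by
  have hmem : mixTime M π (1 / 4) ∈ {t : ℕ | 0 < t ∧ distToStat M π t < 1 / 4} := by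
    obtain ⟨p, hp, hpos⟩ := hErg
    obtain ⟨t, ht, hlt, -⟩ := exists_distToStat_lt hM hπ hstat hp
      ((hM.pow p).dobrushin_lt_one_of_pos hpos)
    exact Nat.sInf_mem ⟨t, ht, hlt⟩
  have hmin : ∀ t, 0 < t → distToStat M π t < 1 / 4 → mixTime M π (1 / 4) ≤ t :=
    fun t ht hlt => Nat.sInf_le ⟨ht, hlt⟩
  generalize mixTime M π (1 / 4) = T at hmem hmin ⊢
  obtain ⟨hT, hTlt⟩ := hmem
  have hT' : (0 : ℝ) < T := by exact_mod_cast hT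
  have hlog : 0 < Real.log 4 := Real.log_pos (by norm_num)
  have hbound : ∀ s : {n : ℕ // 0 < n},
      (1 - dobrushin (M ^ (s : ℕ))) / ((s : ℕ) : ℝ) ≤ (1 + Real.log 4) / T := by
    rintro ⟨s, hs⟩
    have hs' : (0 : ℝ) < s := by exact_mod_cast hs
    rw [div_le_div_iff₀ hs' hT']
    rcases lt_or_ge (dobrushin (M ^ s)) 1 with hκ | hκ
    · obtain ⟨t, ht, hlt, hle⟩ := exists_distToStat_lt hM hπ hstat hs hκ
      have hTt : (T : ℝ) ≤ t := by exact_mod_cast hmin t ht hlt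
      rw [mul_comm]
      exact (mul_le_mul_of_nonneg_right hTt (by linarith)).trans hle
    · exact (mul_nonpos_of_nonpos_of_nonneg (by linarith) hT'.le).trans (by positivity)
  have : Nonempty {n : ℕ // 0 < n} := ⟨⟨1, one_pos⟩⟩
  have hupper : 1 - genCC M ≤ (1 + Real.log 4) / T := by
    rw [genCC, sub_sub_cancel]
    exact ciSup_le hbound
  have hlower : (1 / 2) / T ≤ 1 - genCC M := by
    rw [genCC, sub_sub_cancel]
    refine le_trans ?_ (le_ciSup (f := fun s : {n : ℕ // 0 < n} =>
      (1 - dobrushin (M ^ (s : ℕ))) / ((s : ℕ) : ℝ))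
      ⟨_, Set.forall_mem_range.2 hbound⟩ ⟨T, hT⟩)
    have := dobrushin_pow_le_two_mul_distToStat hM hπ T
    dsimp only
    gcongr
    linarith
  have hG : 0 < 1 - genCC M := lt_of_lt_of_le (by positivity) hlower
  exact ⟨(div_le_comm₀ hT' hG).1 hlower, (le_div_comm₀ hG hT').1 hupper⟩
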